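/- For every h-normal Γ-linear connection of Cartan type and every family of smooth functions Xv^i of (t, x, y), typed as a d-tensor with a single upper vertical index, the following local Ricci identities hold for all indices i, j, k: (Xv^i_/1)_|k − (Xv^i_|k)_/1 = Xv^r R^i_r1k − Xv^i_|r T^r_1k − Xv^i|_(r) Rv^r_1k; (Xv^i_|j)_|k − (Xv^i_|k)_|j = Xv^r R^i_rjk − Xv^i|_(r) Rv^r_jk; (Xv^i_/1)|_(k) − (Xv^i|_(k))_/1 = Xv^r P^i_r1(k) − Xv^i|_(r) Pv^r_1k; (Xv^i_|j)|_(k) − (Xv^i|_(k))_|j = Xv^r P^i_rj(k) − Xv^i_|r C^r_jk − Xv^i|_(r) Pv^r_jk; (Xv^i|_(j))|_(k) − (Xv^i|_(k))|_(j) = Xv^r S^i_r(j)(k). -/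

import Mathlib

open Finset

noncomputable section

namespace Jet

/-- Smooth real-valued functions of `(t, x, y) ∈ ℝ × ℝⁿ × ℝⁿ`, the local coordinates
of the 1-jet space `J¹(ℝ, M)`. -/
abbrev Fn (n : ℕ) : Type := ℝ → (Fin n → ℝ) → (Fin n → ℝ) → ℝ

def Smooth {n : ℕ} (F : Fn n) : Prop :=
  ContDiff ℝ (⊤ : ℕ∞) (fun p : ℝ × (Fin n → ℝ) × (Fin n → ℝ) => F p.1 p.2.1 p.2.2)

/-- Partial derivative in the time variable `t`. -/
def pt {n : ℕ} (F : Fn n) : Fn n := fun t x y => deriv (fun s => F s x y) t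

/-- Partial derivative in the spatial variable `xⁱ`. -/
def px {n : ℕ} (i : Fin n) (F : Fn n) : Fn n :=
  fun t x y => deriv (fun s => F t (Function.update x i s) y) (x i)

/-- Partial derivative in the fibre variable `yⁱ`. -/
def py {n : ℕ} (i : Fin n) (F : Fn n) : Fn n :=
  fun t x y => deriv (fun s => F t x (Function.update y i s)) (y i)

/-- Kronecker delta, as a constant function on the jet space. -/
def kron {n : ℕ} (i j : Fin n) : Fn n := if i = j then 1 else 0

/-- The coordinate function `yⁱ`. -/
def yc {n : ℕ} (i : Fin n) : Fn n := fun _ _ y => y i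

/-- The Christoffel symbol `κ(t) = (1/(2h)) dh/dt` of a Riemannian metric `h` on `ℝ`,
as a function on the jet space. -/
def chr {n : ℕ} (h : ℝ → ℝ) : Fn n := fun t _ _ => deriv h t / (2 * h t)

/-- The metric `h(t)` as a function on the jet space. -/
def hfun {n : ℕ} (h : ℝ → ℝ) : Fn n := fun t _ _ => h t

/-- The derivative `dh/dt` as a function on the jet space. -/
def hder {n : ℕ} (h : ℝ → ℝ) : Fn n := fun t _ _ => deriv h t

variable {n : ℕ}

/-- The adapted temporal derivative `δ/δt = ∂/∂t − Mʳ ∂/∂yʳ` determined by a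
nonlinear connection `(M, N)`. -/
def dt (M : Fin n → Fn n) (F : Fn n) : Fn n := pt F - ∑ r, M r * py r F

/-- The adapted spatial derivative `δ/δxᵏ = ∂/∂xᵏ − Nʳₖ ∂/∂yʳ`. -/
def dx (N : Fin n → Fin n → Fn n) (k : Fin n) (F : Fn n) : Fn n :=
  px k F - ∑ r, N r k * py r F

/-- An `h`-normal `Γ`-linear connection `(κ, Gᵏᵢ, Lᵏᵢⱼ, Cᵏᵢⱼ)`. -/
structure Conn (n : ℕ) where
  κ : Fn n
  G : Fin n → Fin n → Fn n
  L : Fin n → Fin n → Fin n → Fn n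
  C : Fin n → Fin n → Fin n → Fn n

/-! ### Torsion d-tensors -/

/-- `Tʳ₁ⱼ = −Gʳⱼ`. -/
def T1 (Γ : Conn n) (r j : Fin n) : Fn n := -Γ.G r j

/-- `Rvʳ₁ⱼ = (δ/δxʲ)Mʳ − (δ/δt)Nʳⱼ`. -/
def Rv1 (M : Fin n → Fn n) (N : Fin n → Fin n → Fn n) (r j : Fin n) : Fn n :=
  dx N j (M r) - dt M (N r j)

/-- `Tʳᵢⱼ = Lʳᵢⱼ − Lʳⱼᵢ`. -/
def Tsp (Γ : Conn n) (r i j : Fin n) : Fn n := Γ.L r i j - Γ.L r j i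

/-- `Rvʳᵢⱼ = (δ/δxʲ)Nʳᵢ − (δ/δxⁱ)Nʳⱼ`. -/
def Rvsp (M : Fin n → Fn n) (N : Fin n → Fin n → Fn n) (r i j : Fin n) : Fn n :=
  dx N j (N r i) - dx N i (N r j)

/-- `Pvʳ₁ⱼ = ∂Mʳ/∂yʲ − Gʳⱼ + δʳⱼ κ`. -/
def Pv1 (M : Fin n → Fn n) (Γ : Conn n) (r j : Fin n) : Fn n :=
  py j (M r) - Γ.G r j + kron r j * Γ.κ

/-- `Phʳᵢⱼ = Cʳᵢⱼ`. -/
def Phsp (Γ : Conn n) (r i j : Fin n) : Fn n := Γ.C r i j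

/-- `Pvʳᵢⱼ = ∂Nʳᵢ/∂yʲ − Lʳⱼᵢ`. -/
def Pvsp (N : Fin n → Fin n → Fn n) (Γ : Conn n) (r i j : Fin n) : Fn n :=
  py j (N r i) - Γ.L r j i

/-- `Sʳᵢⱼ = Cʳᵢⱼ − Cʳⱼᵢ`. -/
def Ssp (Γ : Conn n) (r i j : Fin n) : Fn n := Γ.C r i j - Γ.C r j i

/-! ### Generic covariant derivatives of d-tensors -/

/-- Index types of the (valued) indices of a d-tensor: upper/lower spatial,
upper/lower vertical.  (Temporal indices carry no value; they are accounted for by the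
temporal weight `p` = number of upper temporal indices minus number of lower temporal
indices.) -/
inductive IdxType | uS | lS | uV | lV

/-- A d-tensor component family with `m` valued indices. -/
abbrev Tensor (n m : ℕ) := (Fin m → Fin n) → Fn n

/-- The `ℝ`-horizontal covariant derivative `D_{/1}` of a d-tensor `D` with valued index
signature `σ` and temporal weight `p`. -/
def covT {m : ℕ} (M : Fin n → Fn n) (Γ : Conn n) (p : ℤ) (σ : Fin m → IdxType)
    (D : Tensor n m) : Tensor n m := fun a =>
  dt M (D a) + p • (Γ.κ * D a)
    + ∑ q : Fin m,
      (match σ q with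
      | .uS => ∑ r, D (Function.update a q r) * Γ.G (a q) r
      | .lS => -∑ r, D (Function.update a q r) * Γ.G r (a q)
      | .uV => ∑ r, D (Function.update a q r) * (Γ.G (a q) r - kron (a q) r * Γ.κ)
      | .lV => -∑ r, D (Function.update a q r) * (Γ.G r (a q) - kron r (a q) * Γ.κ) : Fn n)

/-- The `M`-horizontal covariant derivative `D_{|k}`. -/
def covX {m : ℕ} (N : Fin n → Fin n → Fn n) (Γ : Conn n) (σ : Fin m → IdxType)
    (k : Fin n) (D : Tensor n m) : Tensor n m := fun a =>
  dx N k (D a)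
    + ∑ q : Fin m,
      (match σ q with
      | .uS => ∑ r, D (Function.update a q r) * Γ.L (a q) r k
      | .uV => ∑ r, D (Function.update a q r) * Γ.L (a q) r k
      | .lS => -∑ r, D (Function.update a q r) * Γ.L r (a q) k
      | .lV => -∑ r, D (Function.update a q r) * Γ.L r (a q) k : Fn n)

/-- The vertical covariant derivative `D|_{(k)}`. -/
def covY {m : ℕ} (Γ : Conn n) (σ : Fin m → IdxType)
    (k : Fin n) (D : Tensor n m) : Tensor n m := fun a =>
  py k (D a)
    + ∑ q : Fin m,
      (match σ q with
      | .uS => ∑ r, D (Function.update a q r) * Γ.C (a q) r k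
      | .uV => ∑ r, D (Function.update a q r) * Γ.C (a q) r k
      | .lS => -∑ r, D (Function.update a q r) * Γ.C r (a q) k
      | .lV => -∑ r, D (Function.update a q r) * Γ.C r (a q) k : Fn n)

/-- The coefficients `Cᵏᵢⱼ` viewed as a d-tensor with signature
(upper spatial, lower spatial, lower vertical). -/
def CT (Γ : Conn n) : Tensor n 3 := fun a => Γ.C (a 0) (a 1) (a 2)

/-- The signature of `Cᵏᵢⱼ`. -/
def sigC : Fin 3 → IdxType := ![IdxType.uS, IdxType.lS, IdxType.lV]

/-! ### Curvature d-tensors -/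

/-- `Rˡᵢ₁ₖ`. -/
def Rc1 (M : Fin n → Fn n) (N : Fin n → Fin n → Fn n) (Γ : Conn n) (l i k : Fin n) : Fn n :=
  dx N k (Γ.G l i) - dt M (Γ.L l i k) + ∑ r, Γ.G r i * Γ.L l r k
    - ∑ r, Γ.L r i k * Γ.G l r + ∑ r, Γ.C l i r * Rv1 M N r k

/-- `Rˡᵢⱼₖ`. -/
def Rc (M : Fin n → Fn n) (N : Fin n → Fin n → Fn n) (Γ : Conn n) (l i j k : Fin n) : Fn n :=
  dx N k (Γ.L l i j) - dx N j (Γ.L l i k) + ∑ r, Γ.L r i j * Γ.L l r k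
    - ∑ r, Γ.L r i k * Γ.L l r j + ∑ r, Γ.C l i r * Rvsp M N r j k

/-- `Pˡᵢ₁₍ₖ₎`. -/
def Pc1 (M : Fin n → Fn n) (N : Fin n → Fin n → Fn n) (Γ : Conn n) (l i k : Fin n) : Fn n :=
  py k (Γ.G l i) - covT M Γ 0 sigC (CT Γ) ![l, i, k] + ∑ r, Γ.C l i r * Pv1 M Γ r k

/-- `Pˡᵢⱼ₍ₖ₎`. -/
def Pc (M : Fin n → Fn n) (N : Fin n → Fin n → Fn n) (Γ : Conn n) (l i j k : Fin n) : Fn n :=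
  py k (Γ.L l i j) - covX N Γ sigC j (CT Γ) ![l, i, k] + ∑ r, Γ.C l i r * Pvsp N Γ r j k

/-- `Sˡᵢ₍ⱼ₎₍ₖ₎`. -/
def Sc (Γ : Conn n) (l i j k : Fin n) : Fn n :=
  py k (Γ.C l i j) - py j (Γ.C l i k)
    + ∑ r, Γ.C r i j * Γ.C l r k - ∑ r, Γ.C r i k * Γ.C l r j

end Jet

namespace Jet

variable {n : ℕ}

/-- A family with one valued index, viewed as a d-tensor. -/
def famT (X : Fin n → Fn n) : Tensor n 1 := fun a => X (a 0)

def T1T (Γ : Conn n) : Tensor n 2 := fun a => T1 Γ (a 0) (a 1)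
def Rv1T (M : Fin n → Fn n) (N : Fin n → Fin n → Fn n) : Tensor n 2 :=
  fun a => Rv1 M N (a 0) (a 1)
def RvspT (M : Fin n → Fn n) (N : Fin n → Fin n → Fn n) : Tensor n 3 :=
  fun a => Rvsp M N (a 0) (a 1) (a 2)
def Pv1T (M : Fin n → Fn n) (Γ : Conn n) : Tensor n 2 := fun a => Pv1 M Γ (a 0) (a 1)
def PvspT (N : Fin n → Fin n → Fn n) (Γ : Conn n) : Tensor n 3 :=
  fun a => Pvsp N Γ (a 0) (a 1) (a 2)
def Rc1T (M : Fin n → Fn n) (N : Fin n → Fin n → Fn n) (Γ : Conn n) : Tensor n 3 :=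
  fun a => Rc1 M N Γ (a 0) (a 1) (a 2)
def RcT (M : Fin n → Fn n) (N : Fin n → Fin n → Fn n) (Γ : Conn n) : Tensor n 4 :=
  fun a => Rc M N Γ (a 0) (a 1) (a 2) (a 3)
def Pc1T (M : Fin n → Fn n) (N : Fin n → Fin n → Fn n) (Γ : Conn n) : Tensor n 3 :=
  fun a => Pc1 M N Γ (a 0) (a 1) (a 2)
def PcT (M : Fin n → Fn n) (N : Fin n → Fin n → Fn n) (Γ : Conn n) : Tensor n 4 :=
  fun a => Pc M N Γ (a 0) (a 1) (a 2) (a 3)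
def ScT (Γ : Conn n) : Tensor n 4 := fun a => Sc Γ (a 0) (a 1) (a 2) (a 3)

/-- valued-index signatures (temporal indices are tracked by the weight `p` only) -/
def sig0 : Fin 0 → IdxType := ![]
def siglS : Fin 1 → IdxType := ![IdxType.lS]
def siglV : Fin 1 → IdxType := ![IdxType.lV]
def sigU : Fin 1 → IdxType := ![IdxType.uS]
def sigV : Fin 1 → IdxType := ![IdxType.uV]
def sigUlS : Fin 2 → IdxType := ![IdxType.uS, IdxType.lS]
def sigUlV : Fin 2 → IdxType := ![IdxType.uS, IdxType.lV]
def sigVlS : Fin 2 → IdxType := ![IdxType.uV, IdxType.lS]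
def sigVlV : Fin 2 → IdxType := ![IdxType.uV, IdxType.lV]
def sigRvsp : Fin 3 → IdxType := ![IdxType.uV, IdxType.lS, IdxType.lS]
def sigPvsp : Fin 3 → IdxType := ![IdxType.uV, IdxType.lS, IdxType.lV]
def sigRc1 : Fin 3 → IdxType := ![IdxType.uS, IdxType.lS, IdxType.lS]
def sigRc : Fin 4 → IdxType := ![IdxType.uS, IdxType.lS, IdxType.lS, IdxType.lS]
def sigPc1 : Fin 3 → IdxType := ![IdxType.uS, IdxType.lS, IdxType.lV]
def sigPc : Fin 4 → IdxType := ![IdxType.uS, IdxType.lS, IdxType.lS, IdxType.lV]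
def sigSc : Fin 4 → IdxType := ![IdxType.uS, IdxType.lS, IdxType.lV, IdxType.lV]

end Jet

namespace Jet

variable {n : ℕ}

/-! ### Smooth functions and partial derivatives -/

lemma Smooth.add {F G : Fn n} (hF : Smooth F) (hG : Smooth G) : Smooth (F + G) :=
  ContDiff.add hF hG

lemma Smooth.sub {F G : Fn n} (hF : Smooth F) (hG : Smooth G) : Smooth (F - G) :=
  ContDiff.sub hF hG

lemma Smooth.mul {F G : Fn n} (hF : Smooth F) (hG : Smooth G) : Smooth (F * G) :=
  ContDiff.mul hF hG

lemma smooth_zero : Smooth (0 : Fn n) := contDiff_const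

lemma smooth_kron (i j : Fin n) : Smooth (kron i j) := by
  unfold kron
  split_ifs <;> exact contDiff_const

lemma smooth_sum {ι : Type*} (s : Finset ι) {F : ι → Fn n} (hF : ∀ i, Smooth (F i)) :
    Smooth (∑ i ∈ s, F i) := by
  classical
  induction s using Finset.induction_on with
  | empty => simpa using smooth_zero
  | insert a s ha ih => rw [Finset.sum_insert ha]; exact (hF a).add ih

lemma smooth_chr {h : ℝ → ℝ} (hh : ContDiff ℝ (⊤ : ℕ∞) h) (hpos : ∀ t, 0 < h t) :
    Smooth (chr h : Fn n) := by
  have hd : ContDiff ℝ (⊤ : ℕ∞) (deriv h) := (contDiff_infty_iff_deriv.1 hh).2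
  exact (hd.comp contDiff_fst).div (contDiff_const.mul (hh.comp contDiff_fst))
    fun p => (mul_pos two_pos (hpos p.1)).ne'

/-- A jet-space function as a function on the product space. -/
def uncurried (F : Fn n) (p : ℝ × (Fin n → ℝ) × (Fin n → ℝ)) : ℝ := F p.1 p.2.1 p.2.2

/-- The derivative of a jet-space function in the constant direction `v`. -/
def dirDeriv (v : ℝ × (Fin n → ℝ) × (Fin n → ℝ)) (F : Fn n) : Fn n :=
  fun t x y => fderiv ℝ (uncurried F) (t, x, y) v

lemma Smooth.differentiable {F : Fn n} (hF : Smooth F) : Differentiable ℝ (uncurried F) :=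
  ContDiff.differentiable hF (by simp)

lemma pt_eq_dirDeriv {F : Fn n} (hF : Smooth F) : pt F = dirDeriv (1, 0, 0) F := by
  funext t x y
  have hc : HasDerivAt (fun s : ℝ => (s, x, y)) (1, 0, 0) t :=
    (hasDerivAt_id t).prodMk (hasDerivAt_const t (x, y))
  exact ((hF.differentiable (t, x, y)).hasFDerivAt.comp_hasDerivAt t hc).deriv

lemma px_eq_dirDeriv (i : Fin n) {F : Fn n} (hF : Smooth F) :
    px i F = dirDeriv (0, Pi.single i 1, 0) F := by
  funext t x y
  have hc : HasDerivAt (fun s : ℝ => (t, Function.update x i s, y)) (0, Pi.single i 1, 0) (x i) :=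
    (hasDerivAt_const _ t).prodMk ((hasDerivAt_update x i (x i)).prodMk (hasDerivAt_const _ y))
  have hf := (hF.differentiable (t, Function.update x i (x i), y)).hasFDerivAt.comp_hasDerivAt _ hc
  rw [Function.update_eq_self] at hf
  exact hf.deriv

lemma py_eq_dirDeriv (i : Fin n) {F : Fn n} (hF : Smooth F) :
    py i F = dirDeriv (0, 0, Pi.single i 1) F := by
  funext t x y
  have hc : HasDerivAt (fun s : ℝ => (t, x, Function.update y i s)) (0, 0, Pi.single i 1) (y i) :=
    (hasDerivAt_const _ t).prodMk ((hasDerivAt_const _ x).prodMk (hasDerivAt_update y i (y i)))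
  have hf := (hF.differentiable (t, x, Function.update y i (y i))).hasFDerivAt.comp_hasDerivAt _ hc
  rw [Function.update_eq_self] at hf
  exact hf.deriv

lemma smooth_dirDeriv (v : ℝ × (Fin n → ℝ) × (Fin n → ℝ)) {F : Fn n} (hF : Smooth F) :
    Smooth (dirDeriv v F) :=
  (ContDiff.fderiv_right (m := (⊤ : ℕ∞)) hF (by simp)).clm_apply contDiff_const

lemma dirDeriv_comm (v w : ℝ × (Fin n → ℝ) × (Fin n → ℝ)) {F : Fn n} (hF : Smooth F) :
    dirDeriv v (dirDeriv w F) = dirDeriv w (dirDeriv v F) := by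
  funext t x y
  have hd : DifferentiableAt ℝ (fderiv ℝ (uncurried F)) (t, x, y) :=
    (ContDiff.fderiv_right (m := (⊤ : ℕ∞)) hF (by simp)).differentiable (by simp) _
  have hsymm : IsSymmSndFDerivAt ℝ (uncurried F) (t, x, y) :=
    (ContDiff.contDiffAt hF).isSymmSndFDerivAt (by
      rw [minSmoothness_of_isRCLikeNormedField]
      exact WithTop.coe_le_coe.2 le_top)
  have key (a b : ℝ × (Fin n → ℝ) × (Fin n → ℝ)) :
      dirDeriv a (dirDeriv b F) t x y = fderiv ℝ (fderiv ℝ (uncurried F)) (t, x, y) a b := by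
    change fderiv ℝ (fun p => fderiv ℝ (uncurried F) p b) (t, x, y) a = _
    rw [fderiv_clm_apply hd (differentiableAt_const b)]
    simp
  rw [key, key, hsymm.eq]

/-! ### Derivations of the smooth functions -/

/-- An operator restricting to a derivation of the algebra of smooth functions. -/
structure IsDerivation (D : Fn n → Fn n) : Prop where
  smooth : ∀ {F}, Smooth F → Smooth (D F)
  add : ∀ {F G}, Smooth F → Smooth G → D (F + G) = D F + D G
  mul : ∀ {F G}, Smooth F → Smooth G → D (F * G) = D F * G + F * D G

namespace IsDerivation

variable {D : Fn n → Fn n}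

lemma zero (hD : IsDerivation D) : D 0 = 0 := by
  simpa using hD.add smooth_zero smooth_zero

lemma sub (hD : IsDerivation D) {F G : Fn n} (hF : Smooth F) (hG : Smooth G) :
    D (F - G) = D F - D G := by
  rw [eq_sub_iff_add_eq, ← hD.add (hF.sub hG) hG, sub_add_cancel]

lemma sum (hD : IsDerivation D) {ι : Type*} (s : Finset ι) {F : ι → Fn n}
    (hF : ∀ i, Smooth (F i)) : D (∑ i ∈ s, F i) = ∑ i ∈ s, D (F i) := by
  classical
  induction s using Finset.induction_on with
  | empty => simpa using hD.zero
  | insert a s ha ih =>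
    rw [Finset.sum_insert ha, Finset.sum_insert ha, hD.add (hF a) (smooth_sum s hF), ih]

lemma sum_mul (hD : IsDerivation D) {ι : Type*} (s : Finset ι) {F G : ι → Fn n}
    (hF : ∀ i, Smooth (F i)) (hG : ∀ i, Smooth (G i)) :
    D (∑ i ∈ s, F i * G i) = ∑ i ∈ s, (D (F i) * G i + F i * D (G i)) := by
  rw [hD.sum s fun i => (hF i).mul (hG i)]
  exact Finset.sum_congr rfl fun i _ => hD.mul (hF i) (hG i)

end IsDerivation

lemma isDerivation_dirDeriv (v : ℝ × (Fin n → ℝ) × (Fin n → ℝ)) :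
    IsDerivation (dirDeriv (n := n) v) where
  smooth := smooth_dirDeriv v
  add {F G} hF hG := by
    funext t x y
    change fderiv ℝ (uncurried F + uncurried G) (t, x, y) v = _
    rw [fderiv_add (hF.differentiable _) (hG.differentiable _)]
    rfl
  mul {F G} hF hG := by
    funext t x y
    change fderiv ℝ (uncurried F * uncurried G) (t, x, y) v = _
    rw [fderiv_mul (hF.differentiable _) (hG.differentiable _)]
    simp [dirDeriv, uncurried]
    ring

lemma IsDerivation.congr {D E : Fn n → Fn n} (hE : IsDerivation E)
    (h : ∀ {F}, Smooth F → D F = E F) : IsDerivation D where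
  smooth hF := h hF ▸ hE.smooth hF
  add hF hG := by rw [h hF, h hG, h (hF.add hG), hE.add hF hG]
  mul hF hG := by rw [h hF, h hG, h (hF.mul hG), hE.mul hF hG]

lemma isDerivation_pt : IsDerivation (pt (n := n)) :=
  (isDerivation_dirDeriv _).congr pt_eq_dirDeriv

lemma isDerivation_px (i : Fin n) : IsDerivation (px i) :=
  (isDerivation_dirDeriv _).congr (px_eq_dirDeriv i)

lemma isDerivation_py (i : Fin n) : IsDerivation (py i) :=
  (isDerivation_dirDeriv _).congr (py_eq_dirDeriv i)

/-- The operators `D` and `E` commute on smooth functions. -/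
def CommuteOnSmooth (D E : Fn n → Fn n) : Prop := ∀ {F}, Smooth F → D (E F) = E (D F)

lemma CommuteOnSmooth.of_dirDeriv {D E : Fn n → Fn n} {v w : ℝ × (Fin n → ℝ) × (Fin n → ℝ)}
    (hD : ∀ {F}, Smooth F → D F = dirDeriv v F) (hE : ∀ {F}, Smooth F → E F = dirDeriv w F) :
    CommuteOnSmooth D E := by
  intro F hF
  rw [hE hF, hD hF, hD (smooth_dirDeriv w hF), hE (smooth_dirDeriv v hF), dirDeriv_comm v w hF]

lemma commute_px_pt (i : Fin n) : CommuteOnSmooth (px i) pt :=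
  CommuteOnSmooth.of_dirDeriv (px_eq_dirDeriv i) pt_eq_dirDeriv

lemma commute_px_px (i j : Fin n) : CommuteOnSmooth (px i) (px j) :=
  CommuteOnSmooth.of_dirDeriv (px_eq_dirDeriv i) (px_eq_dirDeriv j)

lemma commute_pt_py (i : Fin n) : CommuteOnSmooth pt (py i) :=
  CommuteOnSmooth.of_dirDeriv pt_eq_dirDeriv (py_eq_dirDeriv i)

lemma commute_px_py (i j : Fin n) : CommuteOnSmooth (px i) (py j) :=
  CommuteOnSmooth.of_dirDeriv (px_eq_dirDeriv i) (py_eq_dirDeriv j)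

lemma commute_py_py (i j : Fin n) : CommuteOnSmooth (py i) (py j) :=
  CommuteOnSmooth.of_dirDeriv (py_eq_dirDeriv i) (py_eq_dirDeriv j)

/-! ### Adapted derivatives and their commutators -/

/-- The operator `P − aʳ ∂/∂yʳ`. -/
def adapted (P : Fn n → Fn n) (a : Fin n → Fn n) (F : Fn n) : Fn n :=
  P F - ∑ r, a r * py r F

lemma IsDerivation.adapted {P : Fn n → Fn n} (hP : IsDerivation P) {a : Fin n → Fn n}
    (ha : ∀ r, Smooth (a r)) : IsDerivation (adapted P a) where
  smooth hF := (hP.smooth hF).sub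
    (smooth_sum _ fun r => (ha r).mul ((isDerivation_py r).smooth hF))
  add {F G} hF hG := by
    have hy (r : Fin n) : a r * py r (F + G) = a r * py r F + a r * py r G := by
      rw [(isDerivation_py r).add hF hG, mul_add]
    simp only [Jet.adapted, hP.add hF hG, hy, Finset.sum_add_distrib]
    ring
  mul {F G} hF hG := by
    have hy (r : Fin n) : a r * py r (F * G) = a r * py r F * G + F * (a r * py r G) := by
      rw [(isDerivation_py r).mul hF hG]
      ring
    simp only [Jet.adapted, hP.mul hF hG, hy, Finset.sum_add_distrib, ← Finset.sum_mul,
      ← Finset.mul_sum]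
    ring

lemma adapted_adapted {P Q : Fn n → Fn n} (hP : IsDerivation P) (hQ : IsDerivation Q)
    (hPy : ∀ r, CommuteOnSmooth P (py r)) {a b : Fin n → Fn n}
    (ha : ∀ r, Smooth (a r)) (hb : ∀ r, Smooth (b r)) {F : Fn n} (hF : Smooth F) :
    adapted P a (adapted Q b F) = P (Q F) - ∑ r, a r * py r (Q F) - ∑ r, b r * py r (P F)
      + ∑ r, ∑ s, b r * a s * py s (py r F) - ∑ r, adapted P a (b r) * py r F := by
  have hD := hP.adapted ha
  have hy (r : Fin n) : Smooth (py r F) := (isDerivation_py r).smooth hF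
  have hterm (r : Fin n) : b r * adapted P a (py r F)
      = b r * py r (P F) - ∑ s, b r * a s * py s (py r F) := by
    rw [adapted, hPy r hF, mul_sub, Finset.mul_sum]
    simp only [mul_assoc]
  have hE : adapted Q b F = Q F - ∑ r, b r * py r F := rfl
  rw [hE, hD.sub (hQ.smooth hF) (smooth_sum _ fun r => (hb r).mul (hy r)),
    hD.sum_mul _ hb hy, Finset.sum_add_distrib]
  simp only [hterm, Finset.sum_sub_distrib]
  rw [adapted]
  ring

lemma adapted_commutator {P Q : Fn n → Fn n} (hP : IsDerivation P) (hQ : IsDerivation Q)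
    (hPQ : CommuteOnSmooth P Q) (hPy : ∀ r, CommuteOnSmooth P (py r))
    (hQy : ∀ r, CommuteOnSmooth Q (py r)) {a b : Fin n → Fn n}
    (ha : ∀ r, Smooth (a r)) (hb : ∀ r, Smooth (b r)) {F : Fn n} (hF : Smooth F) :
    adapted P a (adapted Q b F) - adapted Q b (adapted P a F)
      = -∑ r, py r F * (adapted P a (b r) - adapted Q b (a r)) := by
  have hsym : ∑ r, ∑ s, a r * b s * py s (py r F) = ∑ r, ∑ s, b r * a s * py s (py r F) := by
    rw [Finset.sum_comm]
    refine Finset.sum_congr rfl fun r _ => Finset.sum_congr rfl fun s _ => ?_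
    rw [commute_py_py r s hF, mul_comm (a s)]
  rw [adapted_adapted hP hQ hPy ha hb hF, adapted_adapted hQ hP hQy hb ha hF, hPQ hF, hsym]
  simp only [mul_comm (py _ F), sub_mul, Finset.sum_sub_distrib]
  ring

lemma dt_eq_adapted (M : Fin n → Fn n) : dt M = adapted pt M := rfl

lemma dx_eq_adapted (N : Fin n → Fin n → Fn n) (k : Fin n) :
    dx N k = adapted (px k) (fun r => N r k) := rfl

lemma py_eq_adapted (k : Fin n) : py k = adapted (py k) 0 := by
  funext F
  simp [adapted]

section Commutators

variable {M : Fin n → Fn n} {N : Fin n → Fin n → Fn n}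

lemma dx_dt_commutator (hM : ∀ i, Smooth (M i)) (hN : ∀ i j, Smooth (N i j)) (k : Fin n)
    {F : Fn n} (hF : Smooth F) :
    dx N k (dt M F) - dt M (dx N k F) = -∑ r, py r F * Rv1 M N r k :=
  adapted_commutator (isDerivation_px k) isDerivation_pt (commute_px_pt k) (commute_px_py k)
    commute_pt_py (fun r => hN r k) hM hF

lemma dx_dx_commutator (hN : ∀ i j, Smooth (N i j)) (j k : Fin n) {F : Fn n} (hF : Smooth F) :
    dx N k (dx N j F) - dx N j (dx N k F) = -∑ r, py r F * Rvsp M N r j k :=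
  adapted_commutator (isDerivation_px k) (isDerivation_px j) (commute_px_px k j)
    (commute_px_py k) (commute_px_py j) (fun r => hN r k) (fun r => hN r j) hF

lemma py_dt_commutator (hM : ∀ i, Smooth (M i)) (k : Fin n) {F : Fn n} (hF : Smooth F) :
    py k (dt M F) - dt M (py k F) = -∑ r, py r F * py k (M r) := by
  have := adapted_commutator (isDerivation_py k) isDerivation_pt
    (fun hF => (commute_pt_py k hF).symm) (commute_py_py k) commute_pt_py
    (a := 0) (fun _ => smooth_zero) hM hF
  rw [← py_eq_adapted, ← dt_eq_adapted] at this
  have h0 : dt M 0 = 0 := (isDerivation_pt.adapted hM).zero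
  simpa [h0] using this

lemma py_dx_commutator (hN : ∀ i j, Smooth (N i j)) (j k : Fin n) {F : Fn n} (hF : Smooth F) :
    py k (dx N j F) - dx N j (py k F) = -∑ r, py r F * py k (N r j) := by
  have := adapted_commutator (isDerivation_py k) (isDerivation_px j)
    (fun hF => (commute_px_py j k hF).symm) (commute_py_py k) (commute_px_py j)
    (a := 0) (fun _ => smooth_zero) (fun r => hN r j) hF
  rw [← py_eq_adapted, ← dx_eq_adapted] at this
  have h0 : dx N j 0 = 0 := ((isDerivation_px j).adapted fun r => hN r j).zero
  simpa [h0] using this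

end Commutators

/-- The commutator of the two covariant derivatives `D + A` and `E + B` of a family with one
upper index. -/
lemma covariant_commutator {D E : Fn n → Fn n} (hD : IsDerivation D) (hE : IsDerivation E)
    {A B : Fin n → Fin n → Fn n} (hA : ∀ i r, Smooth (A i r)) (hB : ∀ i r, Smooth (B i r))
    {X : Fin n → Fn n} (hX : ∀ i, Smooth (X i)) (i : Fin n) :
    (D (E (X i) + ∑ r, X r * B i r) + ∑ r, (E (X r) + ∑ s, X s * B r s) * A i r)
      - (E (D (X i) + ∑ r, X r * A i r) + ∑ r, (D (X r) + ∑ s, X s * A r s) * B i r)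
    = (D (E (X i)) - E (D (X i))) + ∑ r, X r * (D (B i r) - E (A i r)
        + ∑ s, B s r * A i s - ∑ s, A s r * B i s) := by
  have hdouble (U V : Fin n → Fin n → Fn n) :
      ∑ r, (∑ s, X s * U r s) * V i r = ∑ r, X r * ∑ s, U s r * V i s := by
    simp only [Finset.sum_mul, Finset.mul_sum]
    rw [Finset.sum_comm]
    simp only [mul_assoc]
  rw [hD.add (hE.smooth (hX i)) (smooth_sum _ fun r => (hX r).mul (hB i r)),
    hE.add (hD.smooth (hX i)) (smooth_sum _ fun r => (hX r).mul (hA i r)),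
    hD.sum_mul _ hX (hB i), hE.sum_mul _ hX (hA i)]
  simp only [add_mul, mul_add, mul_sub, Finset.sum_add_distrib, Finset.sum_sub_distrib, hdouble]
  ring

/-! ### The temporal Christoffel symbol -/

lemma py_chr (h : ℝ → ℝ) (k : Fin n) : py k (chr h) = 0 := by
  funext t x y
  simp [py, chr]

lemma dx_chr (N : Fin n → Fin n → Fn n) (h : ℝ → ℝ) (k : Fin n) : dx N k (chr h) = 0 := by
  have hx : px k (chr h : Fn n) = 0 := by
    funext t x y
    simp [px, chr]
  simp [dx, hx, py_chr]

lemma IsDerivation.kron_mul {D : Fn n → Fn n} (hD : IsDerivation D) {κ : Fn n} (hκ : D κ = 0)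
    (i j : Fin n) : D (kron i j * κ) = 0 := by
  unfold kron
  split_ifs <;> simp [hκ, hD.zero]

lemma sum_mul_kron (A : Fin n → Fn n) (κ : Fn n) (i : Fin n) :
    ∑ r, A r * (kron r i * κ) = A i * κ := by
  simp [kron]

lemma kron_comm (i j : Fin n) : kron i j = kron j i := by
  simp only [kron, eq_comm]

/-! ### Covariant derivatives in components -/

lemma update_one (i r : Fin n) : Function.update ![i] 0 r = ![r] := by
  funext q
  fin_cases q
  rfl

lemma update_two_zero (i j r : Fin n) : Function.update ![i, j] 0 r = ![r, j] := by
  funext q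
  fin_cases q <;> rfl

lemma update_two_one (i j r : Fin n) : Function.update ![i, j] 1 r = ![i, r] := by
  funext q
  fin_cases q <;> rfl

section Components

variable (M : Fin n → Fn n) (N : Fin n → Fin n → Fn n) (Γ : Conn n)

lemma covT_sigV (D : Tensor n 1) (i : Fin n) : covT M Γ 0 sigV D ![i]
    = dt M (D ![i]) + ∑ r, D ![r] * (Γ.G i r - kron i r * Γ.κ) := by
  simp [covT, sigV, update_one]

lemma covX_sigV (D : Tensor n 1) (k i : Fin n) : covX N Γ sigV k D ![i]
    = dx N k (D ![i]) + ∑ r, D ![r] * Γ.L i r k := by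
  simp [covX, sigV, update_one]

lemma covY_sigV (D : Tensor n 1) (k i : Fin n) : covY Γ sigV k D ![i]
    = py k (D ![i]) + ∑ r, D ![r] * Γ.C i r k := by
  simp [covY, sigV, update_one]

lemma covT_sigVlS (D : Tensor n 2) (i k : Fin n) : covT M Γ 0 sigVlS D ![i, k]
    = dt M (D ![i, k]) + ∑ r, D ![r, k] * (Γ.G i r - kron i r * Γ.κ)
      - ∑ r, D ![i, r] * Γ.G r k := by
  simp [covT, sigVlS, Fin.sum_univ_two, update_two_zero, update_two_one]
  ring

lemma covT_sigVlV (D : Tensor n 2) (i k : Fin n) : covT M Γ 0 sigVlV D ![i, k]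
    = dt M (D ![i, k]) + ∑ r, D ![r, k] * (Γ.G i r - kron i r * Γ.κ)
      - ∑ r, D ![i, r] * (Γ.G r k - kron r k * Γ.κ) := by
  simp [covT, sigVlV, Fin.sum_univ_two, update_two_zero, update_two_one]
  ring

lemma covX_sigVlS (D : Tensor n 2) (k i j : Fin n) : covX N Γ sigVlS k D ![i, j]
    = dx N k (D ![i, j]) + ∑ r, D ![r, j] * Γ.L i r k - ∑ r, D ![i, r] * Γ.L r j k := by
  simp [covX, sigVlS, Fin.sum_univ_two, update_two_zero, update_two_one]
  ring

lemma covX_sigVlV (D : Tensor n 2) (k i j : Fin n) : covX N Γ sigVlV k D ![i, j]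
    = dx N k (D ![i, j]) + ∑ r, D ![r, j] * Γ.L i r k - ∑ r, D ![i, r] * Γ.L r j k := by
  simp [covX, sigVlV, Fin.sum_univ_two, update_two_zero, update_two_one]
  ring

lemma covY_sigVlS (D : Tensor n 2) (k i j : Fin n) : covY Γ sigVlS k D ![i, j]
    = py k (D ![i, j]) + ∑ r, D ![r, j] * Γ.C i r k - ∑ r, D ![i, r] * Γ.C r j k := by
  simp [covY, sigVlS, Fin.sum_univ_two, update_two_zero, update_two_one]
  ring

lemma covY_sigVlV (D : Tensor n 2) (k i j : Fin n) : covY Γ sigVlV k D ![i, j]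
    = py k (D ![i, j]) + ∑ r, D ![r, j] * Γ.C i r k - ∑ r, D ![i, r] * Γ.C r j k := by
  simp [covY, sigVlV, Fin.sum_univ_two, update_two_zero, update_two_one]
  ring

lemma covT_CT (l i k : Fin n) : covT M Γ 0 sigC (CT Γ) ![l, i, k]
    = dt M (Γ.C l i k) + ∑ r, Γ.C r i k * Γ.G l r - ∑ r, Γ.C l r k * Γ.G r i
      - ∑ r, Γ.C l i r * (Γ.G r k - kron r k * Γ.κ) := by
  simp [covT, sigC, CT, Fin.sum_univ_three]
  ring

lemma covX_CT (j l i k : Fin n) : covX N Γ sigC j (CT Γ) ![l, i, k]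
    = dx N j (Γ.C l i k) + ∑ r, Γ.C r i k * Γ.L l r j - ∑ r, Γ.C l r k * Γ.L r i j
      - ∑ r, Γ.C l i r * Γ.L r k j := by
  simp [covX, sigC, CT, Fin.sum_univ_three]
  ring

end Components

lemma sum_covY_mul (X Y K : Fin n → Fn n) (C : Fin n → Fin n → Fn n) :
    ∑ r, (Y r + ∑ s, X s * C s r) * K r
      = ∑ r, Y r * K r + ∑ r, X r * ∑ s, C r s * K s := by
  simp only [add_mul, Finset.sum_add_distrib, Finset.sum_mul, Finset.mul_sum]
  congr 1
  rw [Finset.sum_comm]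
  simp only [mul_assoc]

/-- local Ricci identities for a d-tensor `Xⁱ` with a single upper vertical
index, for an `h`-normal Γ-linear connection of Cartan type. -/
theorem ricci_identities_upper_vertical
    (n : ℕ) (hn : 1 ≤ n)
    (h : ℝ → ℝ) (hh : ContDiff ℝ (⊤ : ℕ∞) h) (hhpos : ∀ t, 0 < h t)
    (M : Fin n → Fn n) (N : Fin n → Fin n → Fn n) (Γ : Conn n)
    (hκ : Γ.κ = chr h)
    (hMs : ∀ i, Smooth (M i)) (hNs : ∀ i j, Smooth (N i j))
    (hGs : ∀ k i, Smooth (Γ.G k i)) (hLs : ∀ k i j, Smooth (Γ.L k i j))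
    (hCs : ∀ k i j, Smooth (Γ.C k i j))
    (hLsym : ∀ k i j, Γ.L k i j = Γ.L k j i) (hCsym : ∀ k i j, Γ.C k i j = Γ.C k j i)
    (X : Fin n → Fn n) (hX : ∀ i, Smooth (X i)) :
    (∀ i k, covX N Γ sigV k (covT M Γ 0 sigV (famT X)) ![i]
        - covT M Γ 0 sigVlS (fun a => covX N Γ sigV (a 1) (famT X) ![a 0]) ![i, k]
      = (∑ r, X r * Rc1 M N Γ i r k)
        - (∑ r, (covX N Γ sigV r (famT X) ![i]) * T1 Γ r k)
        - (∑ r, (covY Γ sigV r (famT X) ![i]) * Rv1 M N r k))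
    ∧ (∀ i j k, covX N Γ sigVlS k (fun a => covX N Γ sigV (a 1) (famT X) ![a 0]) ![i, j]
        - covX N Γ sigVlS j (fun a => covX N Γ sigV (a 1) (famT X) ![a 0]) ![i, k]
      = (∑ r, X r * Rc M N Γ i r j k)
        - (∑ r, (covY Γ sigV r (famT X) ![i]) * Rvsp M N r j k))
    ∧ (∀ i k, covY Γ sigV k (covT M Γ 0 sigV (famT X)) ![i]
        - covT M Γ 0 sigVlV (fun a => covY Γ sigV (a 1) (famT X) ![a 0]) ![i, k]
      = (∑ r, X r * Pc1 M N Γ i r k)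
        - (∑ r, (covY Γ sigV r (famT X) ![i]) * Pv1 M Γ r k))
    ∧ (∀ i j k, covY Γ sigVlS k (fun a => covX N Γ sigV (a 1) (famT X) ![a 0]) ![i, j]
        - covX N Γ sigVlV j (fun a => covY Γ sigV (a 1) (famT X) ![a 0]) ![i, k]
      = (∑ r, X r * Pc M N Γ i r j k)
        - (∑ r, (covX N Γ sigV r (famT X) ![i]) * Γ.C r j k)
        - (∑ r, (covY Γ sigV r (famT X) ![i]) * Pvsp N Γ r j k))
    ∧ (∀ i j k, covY Γ sigVlV k (fun a => covY Γ sigV (a 1) (famT X) ![a 0]) ![i, j]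
        - covY Γ sigVlV j (fun a => covY Γ sigV (a 1) (famT X) ![a 0]) ![i, k]
      = (∑ r, X r * Sc Γ i r j k)) := by
  have hκs : Smooth Γ.κ := hκ ▸ smooth_chr hh hhpos
  have hTs (i r : Fin n) : Smooth (Γ.G i r - kron i r * Γ.κ) :=
    (hGs i r).sub ((smooth_kron i r).mul hκs)
  have hdt : IsDerivation (dt M) := isDerivation_pt.adapted hMs
  have hdx (k : Fin n) : IsDerivation (dx N k) := (isDerivation_px k).adapted fun r => hNs r k
  have hdy := isDerivation_py (n := n)
  have hxG (k i r : Fin n) : dx N k (Γ.G i r - kron i r * Γ.κ) = dx N k (Γ.G i r) := by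
    rw [(hdx k).sub (hGs i r) ((smooth_kron i r).mul hκs),
      (hdx k).kron_mul (hκ ▸ dx_chr N h k), sub_zero]
  have hyG (k i r : Fin n) : py k (Γ.G i r - kron i r * Γ.κ) = py k (Γ.G i r) := by
    rw [(hdy k).sub (hGs i r) ((smooth_kron i r).mul hκs),
      (hdy k).kron_mul (hκ ▸ py_chr h k), sub_zero]
  have hcancel (A : Fin n → Fin n → Fn n) (i r : Fin n) :
      ∑ s, (Γ.G s r - kron s r * Γ.κ) * A i s - ∑ s, A s r * (Γ.G i s - kron i s * Γ.κ)
        = ∑ s, Γ.G s r * A i s - ∑ s, A s r * Γ.G i s := by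
    simp only [sub_mul, mul_sub, Finset.sum_sub_distrib, kron_comm i, sum_mul_kron,
      mul_comm (kron _ _ * Γ.κ)]
    ring
  simp only [covT_sigV, covX_sigV, covY_sigV, covT_sigVlS, covT_sigVlV, covX_sigVlS, covX_sigVlV,
    covY_sigVlS, covY_sigVlV, famT, Matrix.cons_val_zero, Matrix.cons_val_one]
  refine ⟨fun i k => ?_, fun i j k => ?_, fun i k => ?_, fun i j k => ?_, fun i j k => ?_⟩
  · have key := covariant_commutator (hdx k) hdt (fun i r => hLs i r k) hTs hX i
    rw [dx_dt_commutator hMs hNs k (hX i)] at key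
    simp only [hxG, add_sub_assoc, hcancel fun i r => Γ.L i r k] at key
    rw [sum_covY_mul X (fun r => py r (X i)) (fun r => Rv1 M N r k) (Γ.C i)]
    simp only [Rc1, T1, mul_neg, Finset.sum_neg_distrib]
    simp only [mul_add, mul_sub, Finset.sum_add_distrib, Finset.sum_sub_distrib] at key ⊢
    linear_combination key
  · have key := covariant_commutator (hdx k) (hdx j) (fun i r => hLs i r k)
      (fun i r => hLs i r j) hX i
    rw [dx_dx_commutator (M := M) hNs j k (hX i)] at key
    rw [sum_covY_mul X (fun r => py r (X i)) (fun r => Rvsp M N r j k) (Γ.C i)]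
    simp only [Rc, hLsym _ k j]
    simp only [mul_add, mul_sub, Finset.sum_add_distrib, Finset.sum_sub_distrib] at key ⊢
    linear_combination key
  · have key := covariant_commutator (hdy k) hdt (fun i r => hCs i r k) hTs hX i
    rw [py_dt_commutator hMs k (hX i)] at key
    simp only [hyG, add_sub_assoc, hcancel fun i r => Γ.C i r k] at key
    have hT := sum_covY_mul X (fun r => py r (X i)) (fun r => Γ.G r k - kron r k * Γ.κ) (Γ.C i)
    rw [sum_covY_mul X (fun r => py r (X i)) (fun r => Pv1 M Γ r k) (Γ.C i)]
    simp only [Pc1, covT_CT, Pv1, mul_comm (Γ.C _ _ k) (Γ.G _ _)]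
    simp only [mul_comm (Γ.C _ _ k) (Γ.G _ _)] at key
    simp only [mul_add, mul_sub, Finset.sum_add_distrib, Finset.sum_sub_distrib] at key hT ⊢
    linear_combination key + hT
  · have key := covariant_commutator (hdy k) (hdx j) (fun i r => hCs i r k)
      (fun i r => hLs i r j) hX i
    rw [py_dx_commutator hNs j k (hX i)] at key
    have hL := sum_covY_mul X (fun r => py r (X i)) (fun r => Γ.L r k j) (Γ.C i)
    rw [sum_covY_mul X (fun r => py r (X i)) (fun r => Pvsp N Γ r j k) (Γ.C i)]
    simp only [Pc, covX_CT, Pvsp, mul_comm (Γ.C _ _ k) (Γ.L _ _ j)]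
    simp only [mul_comm (Γ.C _ _ k) (Γ.L _ _ j)] at key
    simp only [mul_add, mul_sub, Finset.sum_add_distrib, Finset.sum_sub_distrib] at key hL ⊢
    linear_combination key + hL
  · have key := covariant_commutator (hdy k) (hdy j) (fun i r => hCs i r k)
      (fun i r => hCs i r j) hX i
    rw [commute_py_py k j (hX i)] at key
    simp only [Sc, hCsym _ k j]
    linear_combination key

end Jet
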